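/- The function α*(t) := t^{a+1}(1+m/(2t))^{2a+1}(1−m/(2t)) is a special solution on (|m|/2, +∞) of the second-order ODE t²(1+m/(2t))²·α''(t) + t(1+m/(2t))·(−a + (a+2)·m/(2t))·α'(t) − 2(2a+1)·(m/(2t))·α(t) = 0. -/

import Mathlib

open Real MeasureTheory Set Filter

theorem pos_of_abs_half_lt {m t : ℝ} (ht : |m| / 2 < t) : 0 < t ∧ 0 < 1 + m / (2 * t) := by
  have h0 : 0 < t := lt_of_le_of_lt (by positivity) ht
  refine ⟨h0, ?_⟩
  have h1 : 0 < (2 * t + m) / (2 * t) := div_pos (by linarith [neg_abs_le m]) (by positivity)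
  rwa [add_div, div_self (by positivity)] at h1

theorem hasDerivAt_const_div_two_mul (m : ℝ) {t : ℝ} (ht : t ≠ 0) :
    HasDerivAt (fun s : ℝ => m / (2 * s)) (-(m / (2 * t)) / t) t := by
  have h := (hasDerivAt_const t m).fun_div ((hasDerivAt_id' t).const_mul 2)
    (mul_ne_zero two_ne_zero ht)
  refine h.congr_deriv ?_
  field_simp
  ring

theorem hasDerivAt_rpow_mul_rpow_mul (p q m : ℝ) {t f' : ℝ} {f : ℝ → ℝ} (ht : 0 < t)
    (hx : 0 < 1 + m / (2 * t)) (hf : HasDerivAt f f' t) :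
    HasDerivAt (fun s : ℝ => s ^ p * (1 + m / (2 * s)) ^ q * f s)
      (t ^ (p - 1) * (1 + m / (2 * t)) ^ (q - 1) *
        ((p * (1 + m / (2 * t)) - q * (m / (2 * t))) * f t + t * (1 + m / (2 * t)) * f')) t := by
  have h1 := (hasDerivAt_id' t).rpow_const (p := p) (Or.inl ht.ne')
  have h2 := ((hasDerivAt_const_div_two_mul m ht.ne').const_add 1).rpow_const (p := q)
    (Or.inl hx.ne')
  refine ((h1.fun_mul h2).fun_mul hf).congr_deriv ?_
  have e1 : t ^ p = t ^ (p - 1) * t := by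
    rw [← rpow_add_one ht.ne', sub_add_cancel]
  have e2 : (1 + m / (2 * t)) ^ q = (1 + m / (2 * t)) ^ (q - 1) * (1 + m / (2 * t)) := by
    rw [← rpow_add_one hx.ne', sub_add_cancel]
  rw [e1, e2]
  generalize (1 + m / (2 * t)) ^ (q - 1) = B
  generalize t ^ (p - 1) = A
  generalize m / (2 * t) = x
  field_simp
  ring

/-- α*(t) = t^{a+1}(1+m/(2t))^{2a+1}(1−m/(2t)) solves the second-order ODE
t²(1+m/(2t))²α'' + t(1+m/(2t))(−a + (a+2)m/(2t))α' − 2(2a+1)(m/(2t))α = 0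
on (|m|/2, ∞). -/
theorem special_solution_second_order_ode
    (a m : ℝ) (ha : 0 < a)
    (αs : ℝ → ℝ)
    (hαs : ∀ t, αs t = t ^ (a + 1) * (1 + m / (2 * t)) ^ (2 * a + 1) * (1 - m / (2 * t))) :
    ∀ t ∈ Set.Ioi (|m| / 2), ∃ d₁ d₂ : ℝ,
      HasDerivAt αs d₁ t ∧ HasDerivAt (deriv αs) d₂ t ∧
      t ^ (2 : ℕ) * (1 + m / (2 * t)) ^ (2 : ℕ) * d₂ +
        t * (1 + m / (2 * t)) * (-a + (a + 2) * (m / (2 * t))) * d₁ -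
        2 * (2 * a + 1) * (m / (2 * t)) * αs t = 0 := by
  have hfirst : ∀ t, |m| / 2 < t → HasDerivAt αs (t ^ a * (1 + m / (2 * t)) ^ (2 * a) *
      ((a + 1) - 2 * a * (m / (2 * t)) + (a + 1) * (m / (2 * t)) ^ 2)) t := by
    intro t ht
    obtain ⟨h0, hx⟩ := pos_of_abs_half_lt ht
    rw [funext hαs]
    refine (hasDerivAt_rpow_mul_rpow_mul (a + 1) (2 * a + 1) m h0 hx
      ((hasDerivAt_const_div_two_mul m h0.ne').const_sub 1)).congr_deriv ?_
    rw [add_sub_cancel_right, add_sub_cancel_right]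
    congr 1
    generalize m / (2 * t) = x
    field_simp
    ring
  intro t ht
  obtain ⟨h0, hx⟩ := pos_of_abs_half_lt ht
  have hy := hasDerivAt_const_div_two_mul m h0.ne'
  have hsecond := (hasDerivAt_rpow_mul_rpow_mul a (2 * a) m h0 hx
    (((hy.const_mul (2 * a)).const_sub (a + 1)).fun_add
      ((hy.fun_pow 2).const_mul (a + 1)))).congr_of_eventuallyEq
    (f₁ := deriv αs) (by
      filter_upwards [Ioi_mem_nhds ht] with s hs using (hfirst s hs).deriv)
  refine ⟨_, _, hfirst t ht, hsecond, ?_⟩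
  have e1 : t ^ (a + 1) = t ^ (a - 1) * t ^ 2 := by
    rw [← rpow_natCast, ← rpow_add h0]
    congr 1
    norm_num
    ring
  have e2 : t ^ a = t ^ (a - 1) * t := by
    rw [← rpow_add_one h0.ne', sub_add_cancel]
  have e3 : (1 + m / (2 * t)) ^ (2 * a + 1) =
      (1 + m / (2 * t)) ^ (2 * a - 1) * (1 + m / (2 * t)) ^ 2 := by
    rw [← rpow_natCast, ← rpow_add hx]
    congr 1
    norm_num
    ring
  have e4 : (1 + m / (2 * t)) ^ (2 * a) =
      (1 + m / (2 * t)) ^ (2 * a - 1) * (1 + m / (2 * t)) := by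
    rw [← rpow_add_one hx.ne', sub_add_cancel]
  rw [hαs, e1, e2, e3, e4]
  generalize (1 + m / (2 * t)) ^ (2 * a - 1) = B
  generalize t ^ (a - 1) = A
  generalize m / (2 * t) = x
  norm_num
  field_simp
  ring
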